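/- Let d ≥ 2 be an integer, let r and r' be purely imaginary, and let t > 0 be real. Then Ψ^d(r,r',t) = ((2π)^{4−3t}/(2^{d+2}π²)) · Γ(d−1+2t−r−r') · Γ(d−1+t+r+r') · ∫₀¹∫₀¹ x₁^{((d−1)/2+2t+2r−r')/2−1} (1−x₁)^{((d−1)/2+t+r'−2r)/2−1} x₂^{((d−1)/2+2t+2r'−r)/2−1} (1−x₂)^{((d−1)/2+t+r−2r')/2−1} · (1+√(x₁x₂)+√(1−x₁)·√(1−x₂))^d · (√x₁+√x₂)^{−(d−1+2t−r−r')} · (√(1−x₁)+√(1−x₂))^{−(d−1+t+r+r')} dx₁ dx₂. -/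

import Mathlib

open Complex Real Set MeasureTheory Finset

/-- The beta function `B(u,v) = Γ(u)Γ(v)/Γ(u+v)`. -/
noncomputable def cBeta (u v : ℂ) : ℂ := Complex.Gamma u * Complex.Gamma v / Complex.Gamma (u + v)

/-- The completed Whittaker function `W^{d*}_{m'}(y, r)`, defined via its Mellin-Barnes
integral with the contours placed at `σ₁ = σ₂ = 1`. -/
noncomputable def Wstar (d : ℕ) (r : ℂ) (y₁ y₂ : ℝ) (m' : ℤ) : ℂ :=
  ((2 : ℂ) ^ (d + 1) * (Real.pi : ℂ))⁻¹ *
    (Real.sqrt ((2 * d).choose (d + m'.natAbs)) : ℂ) *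
    ∑ ℓ ∈ Finset.range (m'.natAbs + 1),
      (if 0 ≤ m' then (1 : ℂ) else -1) ^ ℓ * ((m'.natAbs).choose ℓ : ℂ) *
        (((2 * Real.pi : ℝ) : ℂ))⁻¹ ^ 2 *
          ∫ t : ℝ × ℝ,
            ((2 * Real.pi * y₁ : ℝ) : ℂ) ^ (1 - ((1 : ℂ) + Complex.I * t.1)) *
              ((2 * Real.pi * y₂ : ℝ) : ℂ) ^ (1 - ((1 : ℂ) + Complex.I * t.2)) *
                Complex.Gamma (((d : ℂ) - 1) / 2 + ((1 : ℂ) + Complex.I * t.1) - r) *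
                  Complex.Gamma (((d : ℂ) - 1) / 2 + ((1 : ℂ) + Complex.I * t.2) + r) *
                    cBeta (((d : ℂ) - (m'.natAbs : ℂ) + ((1 : ℂ) + Complex.I * t.1) + 2 * r) / 2)
                      (((ℓ : ℂ) + ((1 : ℂ) + Complex.I * t.2) - 2 * r) / 2)

/-- The Rankin-Selberg local zeta integral `Ψ^d(r, r', t)`. -/
noncomputable def Psi (d : ℕ) (r r' t : ℂ) : ℂ :=
  ∫ y₁ in Set.Ioi (0 : ℝ), ∫ y₂ in Set.Ioi (0 : ℝ),
    (∑ m' ∈ Finset.Icc (-(d : ℤ)) (d : ℤ), Wstar d r y₁ y₂ m' * Wstar d r' y₁ y₂ m') *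
      ((y₁ ^ 2 * y₂ : ℝ) : ℂ) ^ t / ((y₁ * y₂ : ℝ) : ℂ) ^ 3

/-- The Gamma function is bounded on vertical lines in the right half-plane. -/
lemma norm_Gamma_le_Gamma_re {s : ℂ} (hs : 0 < s.re) :
    ‖Complex.Gamma s‖ ≤ Real.Gamma s.re := by
  rw [Complex.Gamma_eq_integral hs, Real.Gamma_eq_integral hs, Complex.GammaIntegral]
  refine (norm_integral_le_integral_norm _).trans_eq ?_
  refine setIntegral_congr_fun measurableSet_Ioi fun x hx => ?_
  have hx : 0 < x := hx
  simp only [norm_mul, Complex.norm_real, Complex.norm_cpow_eq_rpow_re_of_pos hx]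
  rw [Real.norm_of_nonneg (Real.exp_pos _).le]
  simp

/-- The Gamma function is integrable on vertical lines in the right half-plane. -/
lemma integrable_Gamma_vertical {A : ℂ} (hA : 0 < A.re) :
    Integrable fun t : ℝ => Complex.Gamma (A + Complex.I * t) := by
  have hre : ∀ t : ℝ, (A + Complex.I * t).re = A.re := fun t => by simp
  have him : ∀ t : ℝ, (A + Complex.I * t).im = A.im + t := fun t => by simp
  have hcont : Continuous fun t : ℝ => Complex.Gamma (A + Complex.I * t) := by
    rw [continuous_iff_continuousAt]
    intro t
    refine ContinuousAt.comp (f := fun t : ℝ => A + Complex.I * t) (g := Complex.Gamma) ?_ (by fun_prop)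
    refine (Complex.differentiableAt_Gamma _ fun m h => ?_).continuousAt
    have := congrArg Complex.re h
    rw [hre] at this
    simp at this
    linarith [(Nat.cast_nonneg m : (0 : ℝ) ≤ m)]
  set c : ℝ := min (A.re ^ 2) 1 with hc
  have hc0 : 0 < c := by positivity
  have hinteg : Integrable fun t : ℝ => Real.Gamma (A.re + 2) / c * (1 + (A.im + t) ^ 2)⁻¹ :=
    (integrable_inv_one_add_sq.comp_add_left A.im).const_mul _
  refine hinteg.mono' hcont.aestronglyMeasurable (Filter.Eventually.of_forall fun t => ?_)
  set s := A + Complex.I * t with hs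
  have hsre : s.re = A.re := hre t
  have hs0 : s ≠ 0 := fun h => by rw [h] at hsre; simp at hsre; linarith
  have hs1 : s + 1 ≠ 0 := fun h => by
    have := congrArg Complex.re h
    simp [hsre] at this; linarith
  have hG : Complex.Gamma (s + 2) = (s + 1) * (s * Complex.Gamma s) := by
    rw [← Complex.Gamma_add_one _ hs0, ← Complex.Gamma_add_one _ hs1]; ring_nf
  have hn := norm_Gamma_le_Gamma_re (s := s + 2) (by simp [hsre]; linarith)
  rw [hG, norm_mul, norm_mul] at hn
  have hsq : ‖s‖ ^ 2 = A.re ^ 2 + (A.im + t) ^ 2 := by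
    rw [← Complex.normSq_eq_norm_sq, Complex.normSq_apply, hsre, hs, him]; ring
  have hsq1 : ‖s + 1‖ ^ 2 = (A.re + 1) ^ 2 + (A.im + t) ^ 2 := by
    rw [← Complex.normSq_eq_norm_sq, Complex.normSq_apply]
    simp only [Complex.add_re, Complex.add_im, hsre, Complex.one_re, Complex.one_im]
    rw [hs, him]; ring
  have hle : ‖s‖ ≤ ‖s + 1‖ := by
    refine le_of_sq_le_sq ?_ (norm_nonneg _)
    rw [hsq, hsq1]; nlinarith
  have hlow : c * (1 + (A.im + t) ^ 2) ≤ ‖s‖ ^ 2 := by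
    rw [hsq]
    have h1 : c ≤ A.re ^ 2 := min_le_left _ _
    have h2 : c ≤ 1 := min_le_right _ _
    nlinarith [sq_nonneg (A.im + t)]
  have hre2 : (s + 2).re = A.re + 2 := by simp [hsre]
  rw [hre2] at hn
  rw [← div_eq_mul_inv, div_div, le_div_iff₀ (by positivity)]
  calc ‖Complex.Gamma s‖ * (c * (1 + (A.im + t) ^ 2)) ≤ ‖Complex.Gamma s‖ * (‖s‖ ^ 2) := by gcongr
    _ ≤ ‖s + 1‖ * (‖s‖ * ‖Complex.Gamma s‖) := by
        have := mul_le_mul_of_nonneg_right hle (mul_nonneg (norm_nonneg s) (norm_nonneg (Complex.Gamma s)))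
        linarith
    _ ≤ _ := hn

/-- Mellin inversion for the Gamma function. -/
lemma integral_cpow_mul_Gamma_vertical {A : ℂ} (hA : 0 < A.re) {Y : ℝ} (hY : 0 < Y) :
    ∫ t : ℝ, (Y : ℂ) ^ (-(Complex.I * t)) * Complex.Gamma (A + Complex.I * t) =
      2 * Real.pi * ((Y : ℂ) ^ A * Complex.exp (-Y)) := by
  let f : ℝ → ℂ := fun x => (x : ℂ) ^ A • Complex.exp (-x)
  have hm : ∀ s : ℂ, 0 < (s + A).re → mellin f s = Complex.Gamma (s + A) := by
    intro s hs
    rw [mellin_cpow_smul, Complex.Gamma_eq_integral hs, Complex.GammaIntegral_eq_mellin]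
    simp
  have hconv : MellinConvergent f ((0 : ℝ) : ℂ) := by
    rw [MellinConvergent.cpow_smul]
    have := Complex.GammaIntegral_convergent (s := A) hA
    refine this.congr_fun (fun x _ => ?_) measurableSet_Ioi
    simp [mul_comm]
  have hmv : ∀ t : ℝ, mellin f (((0 : ℝ) : ℂ) + t * Complex.I) = Complex.Gamma (A + Complex.I * t) := by
    intro t
    rw [hm _ (by simpa using hA)]
    congr 1; push_cast; ring
  have key := mellinInv_mellin_eq 0 f hY hconv
    ((integrable_Gamma_vertical hA).congr (Filter.Eventually.of_forall fun t => (hmv t).symm)) (by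
      refine ContinuousAt.smul (f := fun x : ℝ => (x : ℂ) ^ A) ?_ (by fun_prop)
      exact (Complex.continuousAt_ofReal_cpow_const Y A (Or.inr hY.ne')))
  unfold mellinInv at key
  simp_rw [hmv] at key
  have e : ∀ t : ℝ, (Y : ℂ) ^ (-(((0 : ℝ) : ℂ) + t * Complex.I)) • Complex.Gamma (A + Complex.I * t) =
      (Y : ℂ) ^ (-(Complex.I * t)) * Complex.Gamma (A + Complex.I * t) := by
    intro t
    rw [smul_eq_mul]
    congr 3
    push_cast
    ring
  simp_rw [e] at key
  have key' : (Y : ℂ) ^ A * Complex.exp (-Y) = (1 / (2 * Real.pi) : ℝ) •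
      ∫ t : ℝ, (Y : ℂ) ^ (-(Complex.I * t)) * Complex.Gamma (A + Complex.I * t) := key.symm
  rw [key', Complex.real_smul]
  push_cast
  field_simp

lemma ofReal_div_sqrt_cpow {p x : ℝ} (hp : 0 < p) (hx : 0 < x) (w : ℂ) :
    ((p / √x : ℝ) : ℂ) ^ w = (p : ℂ) ^ w * (x : ℂ) ^ (-w / 2) := by
  have hs : 0 < √x := Real.sqrt_pos.2 hx
  rw [Complex.cpow_def_of_ne_zero (by exact_mod_cast (div_pos hp hs).ne'),
    Complex.cpow_def_of_ne_zero (by exact_mod_cast hp.ne'),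
    Complex.cpow_def_of_ne_zero (by exact_mod_cast hx.ne'), ← Complex.exp_add,
    ← Complex.ofReal_log (div_pos hp hs).le, ← Complex.ofReal_log hp.le, ← Complex.ofReal_log hx.le,
    Real.log_div hp.ne' hs.ne', Real.log_sqrt hx.le]
  congr 1
  push_cast
  ring

lemma integrableOn_beta_kernel {u v : ℂ} (hu : 0 < u.re) (hv : 0 < v.re) :
    IntegrableOn (fun x : ℝ => (x : ℂ) ^ (u - 1) * ((1 - x : ℝ) : ℂ) ^ (v - 1)) (Set.Ioo 0 1) := by
  have h := Complex.betaIntegral_convergent hu hv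
  rw [intervalIntegrable_iff_integrableOn_Ioo_of_le zero_le_one] at h
  simpa using h

lemma cBeta_eq_integral {u v : ℂ} (hu : 0 < u.re) (hv : 0 < v.re) :
    cBeta u v = ∫ x : ℝ in Set.Ioo 0 1, (x : ℂ) ^ (u - 1) * ((1 - x : ℝ) : ℂ) ^ (v - 1) := by
  have h0 : Complex.Gamma (u + v) ≠ 0 :=
    Complex.Gamma_ne_zero_of_re_pos (by rw [Complex.add_re]; exact add_pos hu hv)
  rw [cBeta, Complex.Gamma_mul_Gamma_eq_betaIntegral hu hv, mul_div_cancel_left₀ _ h0,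
    Complex.betaIntegral, intervalIntegral.integral_of_le zero_le_one,
    integral_Ioc_eq_integral_Ioo]
  simp

/-- The elementary integrand that a double Mellin-Barnes integral against a beta function
unfolds to. -/
noncomputable def barnesKernel (A₁ A₂ u v : ℂ) (p₁ p₂ x : ℝ) : ℂ :=
  ((x : ℂ) ^ (u - 1) * ((1 - x : ℝ) : ℂ) ^ (v - 1)) *
    (((p₁ / √x : ℝ) : ℂ) ^ A₁ * Complex.exp (-((p₁ / √x : ℝ) : ℂ))) *
      (((p₂ / √(1 - x) : ℝ) : ℂ) ^ A₂ * Complex.exp (-((p₂ / √(1 - x) : ℝ) : ℂ)))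

lemma integrableOn_barnesKernel_and_integral {A₁ A₂ u v : ℂ} (hA₁ : 0 < A₁.re) (hA₂ : 0 < A₂.re)
    (hu : 0 < u.re) (hv : 0 < v.re) {p₁ p₂ : ℝ} (hp₁ : 0 < p₁) (hp₂ : 0 < p₂) :
    IntegrableOn (barnesKernel A₁ A₂ u v p₁ p₂) (Set.Ioo 0 1) ∧
    ∫ t : ℝ × ℝ, (p₁ : ℂ) ^ (-(Complex.I * t.1)) * (p₂ : ℂ) ^ (-(Complex.I * t.2)) *
        Complex.Gamma (A₁ + Complex.I * t.1) * Complex.Gamma (A₂ + Complex.I * t.2) *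
          cBeta (u + Complex.I * t.1 / 2) (v + Complex.I * t.2 / 2) =
      (2 * Real.pi) ^ 2 * ∫ x in Set.Ioo 0 1, barnesKernel A₁ A₂ u v p₁ p₂ x := by
  let F : ℝ × ℝ → ℝ → ℂ := fun t x => ((x : ℂ) ^ (u - 1) * ((1 - x : ℝ) : ℂ) ^ (v - 1)) *
    (((p₁ / √x : ℝ) : ℂ) ^ (-(Complex.I * t.1)) * Complex.Gamma (A₁ + Complex.I * t.1)) *
    (((p₂ / √(1 - x) : ℝ) : ℂ) ^ (-(Complex.I * t.2)) * Complex.Gamma (A₂ + Complex.I * t.2))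
  have hF : Integrable (Function.uncurry F)
      ((volume : Measure (ℝ × ℝ)).prod (volume.restrict (Set.Ioo (0 : ℝ) 1))) := by
    have h1 : Integrable (fun t : ℝ × ℝ => Complex.Gamma (A₁ + Complex.I * t.1) *
        Complex.Gamma (A₂ + Complex.I * t.2)) :=
      (integrable_Gamma_vertical hA₁).mul_prod (integrable_Gamma_vertical hA₂)
    have h2 := h1.mul_prod (integrableOn_beta_kernel hu hv).integrable
    have h3 := h2.bdd_mul (c := 1) (f := fun z : (ℝ × ℝ) × ℝ =>
      ((p₁ / √z.2 : ℝ) : ℂ) ^ (-(Complex.I * z.1.1)) *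
        ((p₂ / √(1 - z.2) : ℝ) : ℂ) ^ (-(Complex.I * z.1.2)))
      (by
        apply Measurable.aestronglyMeasurable
        fun_prop) (by
        have : ∀ᵐ z ∂((volume : Measure (ℝ × ℝ)).prod (volume.restrict (Set.Ioo (0 : ℝ) 1))),
            z.2 ∈ Set.Ioo (0 : ℝ) 1 :=
          Measure.quasiMeasurePreserving_snd.ae (ae_restrict_mem measurableSet_Ioo)
        filter_upwards [this] with z hz
        have hx : 0 < p₁ / √z.2 := div_pos hp₁ (Real.sqrt_pos.2 hz.1)
        have hy : 0 < p₂ / √(1 - z.2) := div_pos hp₂ (Real.sqrt_pos.2 (by linarith [hz.2]))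
        rw [norm_mul, Complex.norm_cpow_eq_rpow_re_of_pos hx, Complex.norm_cpow_eq_rpow_re_of_pos hy]
        simp)
    refine h3.congr (Filter.Eventually.of_forall fun z => ?_)
    simp only [F, Function.uncurry]
    ring
  have hleft : ∀ t : ℝ × ℝ, ∫ x in Set.Ioo 0 1, F t x =
      (p₁ : ℂ) ^ (-(Complex.I * t.1)) * (p₂ : ℂ) ^ (-(Complex.I * t.2)) *
        Complex.Gamma (A₁ + Complex.I * t.1) * Complex.Gamma (A₂ + Complex.I * t.2) *
          cBeta (u + Complex.I * t.1 / 2) (v + Complex.I * t.2 / 2) := by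
    intro t
    rw [cBeta_eq_integral (by simpa using hu) (by simpa using hv), ← integral_const_mul]
    refine setIntegral_congr_fun measurableSet_Ioo fun x hx => ?_
    have h1x : 0 < 1 - x := by linarith [hx.2]
    have hx0 : (x : ℂ) ≠ 0 := by exact_mod_cast hx.1.ne'
    have hx1 : ((1 - x : ℝ) : ℂ) ≠ 0 := by exact_mod_cast h1x.ne'
    simp only [F]
    rw [ofReal_div_sqrt_cpow hp₁ hx.1, ofReal_div_sqrt_cpow hp₂ h1x,
      show u + Complex.I * t.1 / 2 - 1 = (u - 1) + -(-(Complex.I * t.1)) / 2 by ring,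
      show v + Complex.I * t.2 / 2 - 1 = (v - 1) + -(-(Complex.I * t.2)) / 2 by ring,
      Complex.cpow_add _ _ hx0, Complex.cpow_add _ _ hx1]
    ring
  have hright : ∀ x ∈ Set.Ioo (0 : ℝ) 1, ∫ t : ℝ × ℝ, F t x =
      (2 * Real.pi) ^ 2 * barnesKernel A₁ A₂ u v p₁ p₂ x := by
    intro x hx
    have hx0 : 0 < p₁ / √x := div_pos hp₁ (Real.sqrt_pos.2 hx.1)
    have hx1 : 0 < p₂ / √(1 - x) := div_pos hp₂ (Real.sqrt_pos.2 (by linarith [hx.2]))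
    simp only [F, mul_assoc]
    rw [integral_const_mul, integral_const_mul]
    have := integral_prod_mul (μ := (volume : Measure ℝ)) (ν := (volume : Measure ℝ))
      (fun t : ℝ => ((p₁ / √x : ℝ) : ℂ) ^ (-(Complex.I * t)) * Complex.Gamma (A₁ + Complex.I * t))
      (fun t : ℝ => ((p₂ / √(1 - x) : ℝ) : ℂ) ^ (-(Complex.I * t)) * Complex.Gamma (A₂ + Complex.I * t))
    rw [integral_cpow_mul_Gamma_vertical hA₁ hx0, integral_cpow_mul_Gamma_vertical hA₂ hx1] at this
    simp only [mul_assoc, ← Measure.volume_eq_prod] at this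
    rw [this, barnesKernel]
    ring
  constructor
  · have h := hF.integral_prod_right
    have h' : IntegrableOn (fun x => (2 * Real.pi : ℂ) ^ 2 * barnesKernel A₁ A₂ u v p₁ p₂ x)
        (Set.Ioo 0 1) :=
      IntegrableOn.congr_fun h hright measurableSet_Ioo
    have hpi : (2 * Real.pi : ℂ) ^ 2 ≠ 0 := by
      have := Real.pi_ne_zero
      simp
    refine (Integrable.const_mul h' ((2 * Real.pi : ℂ) ^ 2)⁻¹).congr
      (Filter.Eventually.of_forall fun x => ?_)
    simp only
    field_simp
  · simp_rw [← hleft]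
    rw [integral_integral_swap hF, ← integral_const_mul]
    exact setIntegral_congr_fun measurableSet_Ioo hright

/-- The weight-independent factor of the integrand of `Wstar` after unfolding. -/
noncomputable def whittakerKernel (d : ℕ) (r : ℂ) (p₁ p₂ x : ℝ) : ℂ :=
  (p₁ : ℂ) ^ (((d : ℂ) - 1) / 2 + 1 - r) * (p₂ : ℂ) ^ (((d : ℂ) - 1) / 2 + 1 + r) *
    (x : ℂ) ^ ((d : ℂ) / 2 + (r - 1 - (((d : ℂ) - 1) / 2 - r) / 2)) *
      ((1 - x : ℝ) : ℂ) ^ (-r - 1 - (((d : ℂ) - 1) / 2 + r) / 2) *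
        Complex.exp (-((p₁ / √x : ℝ) : ℂ)) * Complex.exp (-((p₂ / √(1 - x) : ℝ) : ℂ))

/-- The ratio whose `m'`-th power is the weight-dependent factor of the integrand of `Wstar`. -/
noncomputable def weightRatio (x : ℝ) : ℝ := (1 + √(1 - x)) / √x

lemma ofReal_sqrt_pow_eq_cpow {x : ℝ} (hx : 0 < x) (n : ℕ) :
    ((√x : ℝ) : ℂ) ^ n = (x : ℂ) ^ ((n : ℂ) / 2) := by
  have h := ofReal_div_sqrt_cpow one_pos hx (-(n : ℂ))
  rw [Complex.ofReal_one, Complex.one_cpow, one_mul, neg_neg, Complex.cpow_neg,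
    Complex.cpow_natCast] at h
  rw [← h]
  push_cast
  rw [one_div, inv_pow, inv_inv]

lemma barnesKernel_eq_whittakerKernel (d m ℓ : ℕ) (r : ℂ) {p₁ p₂ x : ℝ} (hp₁ : 0 < p₁)
    (hp₂ : 0 < p₂) (hx : x ∈ Set.Ioo (0 : ℝ) 1) :
    barnesKernel (((d : ℂ) - 1) / 2 + 1 - r) (((d : ℂ) - 1) / 2 + 1 + r)
        (((d : ℂ) - m + 1 + 2 * r) / 2) (((ℓ : ℂ) + 1 - 2 * r) / 2) p₁ p₂ x =
      whittakerKernel d r p₁ p₂ x * ((√(1 - x) : ℝ) : ℂ) ^ ℓ / ((√x : ℝ) : ℂ) ^ m := by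
  have h1x : 0 < 1 - x := by linarith [hx.2]
  have hx0 : (x : ℂ) ≠ 0 := by exact_mod_cast hx.1.ne'
  have hx1 : ((1 - x : ℝ) : ℂ) ≠ 0 := by exact_mod_cast h1x.ne'
  rw [barnesKernel, whittakerKernel, ofReal_div_sqrt_cpow hp₁ hx.1, ofReal_div_sqrt_cpow hp₂ h1x,
    ofReal_sqrt_pow_eq_cpow hx.1, ofReal_sqrt_pow_eq_cpow h1x, div_eq_mul_inv _ ((x : ℂ) ^ _),
    ← Complex.cpow_neg]
  have e1 : (x : ℂ) ^ ((d : ℂ) / 2 + (r - 1 - (((d : ℂ) - 1) / 2 - r) / 2)) * (x : ℂ) ^ (-((m : ℂ) / 2)) =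
      (x : ℂ) ^ (((d : ℂ) - m + 1 + 2 * r) / 2 - 1) *
        (x : ℂ) ^ (-(((d : ℂ) - 1) / 2 + 1 - r) / 2) := by
    rw [← Complex.cpow_add _ _ hx0, ← Complex.cpow_add _ _ hx0]
    ring_nf
  have e2 : ((1 - x : ℝ) : ℂ) ^ (-r - 1 - (((d : ℂ) - 1) / 2 + r) / 2) *
        ((1 - x : ℝ) : ℂ) ^ ((ℓ : ℂ) / 2) =
      ((1 - x : ℝ) : ℂ) ^ (((ℓ : ℂ) + 1 - 2 * r) / 2 - 1) *
        ((1 - x : ℝ) : ℂ) ^ (-(((d : ℂ) - 1) / 2 + 1 + r) / 2) := by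
    rw [← Complex.cpow_add _ _ hx1, ← Complex.cpow_add _ _ hx1]
    ring_nf
  linear_combination (-(p₁ : ℂ) ^ (((d : ℂ) - 1) / 2 + 1 - r) * (p₂ : ℂ) ^ (((d : ℂ) - 1) / 2 + 1 + r) *
    Complex.exp (-((p₁ / √x : ℝ) : ℂ)) * Complex.exp (-((p₂ / √(1 - x) : ℝ) : ℂ))) *
    (e1 * (((1 - x : ℝ) : ℂ) ^ (-r - 1 - (((d : ℂ) - 1) / 2 + r) / 2) *
        ((1 - x : ℝ) : ℂ) ^ ((ℓ : ℂ) / 2)) + ((x : ℂ) ^ (((d : ℂ) - m + 1 + 2 * r) / 2 - 1) *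
        (x : ℂ) ^ (-(((d : ℂ) - 1) / 2 + 1 - r) / 2)) * e2)

lemma weightRatio_pos {x : ℝ} (hx : x ∈ Set.Ioo (0 : ℝ) 1) : 0 < weightRatio x :=
  div_pos (by positivity) (Real.sqrt_pos.2 hx.1)

lemma weightRatio_inv {x : ℝ} (hx : x ∈ Set.Ioo (0 : ℝ) 1) :
    (weightRatio x)⁻¹ = (1 - √(1 - x)) / √x := by
  have h0 : 0 < √x := Real.sqrt_pos.2 hx.1
  have h1 : 0 < 1 + √(1 - x) := by positivity
  rw [weightRatio, inv_div, div_eq_div_iff h1.ne' h0.ne']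
  nlinarith [Real.sq_sqrt hx.1.le, Real.sq_sqrt (show 0 ≤ 1 - x by linarith [hx.2])]

lemma sum_choose_mul_sqrt_pow (m' : ℤ) {x : ℝ} (hx : x ∈ Set.Ioo (0 : ℝ) 1) :
    (∑ ℓ ∈ Finset.range (m'.natAbs + 1), (if 0 ≤ m' then (1 : ℂ) else -1) ^ ℓ *
        ((m'.natAbs).choose ℓ : ℂ) * ((√(1 - x) : ℝ) : ℂ) ^ ℓ) / ((√x : ℝ) : ℂ) ^ m'.natAbs =
      (weightRatio x : ℂ) ^ m' := by
  have hb := add_pow ((if 0 ≤ m' then (1 : ℂ) else -1) * ((√(1 - x) : ℝ) : ℂ)) 1 m'.natAbs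
  simp only [one_pow, mul_one, mul_pow] at hb
  rw [Finset.sum_congr rfl fun ℓ _ => mul_right_comm _ _ _, ← hb, ← div_pow]
  rcases le_or_gt 0 m' with h | h
  · rw [if_pos h]
    conv_rhs => rw [← Int.natAbs_of_nonneg h, zpow_natCast]
    congr 1
    rw [weightRatio]
    push_cast
    ring
  · rw [if_neg (not_le.2 h)]
    conv_rhs => rw [show m' = -(m'.natAbs : ℤ) by omega, zpow_neg, zpow_natCast, ← inv_pow]
    congr 1
    rw [← Complex.ofReal_inv, weightRatio_inv hx]
    push_cast
    ring

/-- The completed Whittaker function as an elementary one-dimensional integral. -/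
lemma Wstar_eq_integral {d : ℕ} (hd : 2 ≤ d) {r : ℂ} (hr : r.re = 0) {y₁ y₂ : ℝ} (hy₁ : 0 < y₁)
    (hy₂ : 0 < y₂) {m' : ℤ} (hm' : m' ∈ Finset.Icc (-(d : ℤ)) (d : ℤ)) :
    IntegrableOn (fun x => whittakerKernel d r (2 * Real.pi * y₁) (2 * Real.pi * y₂) x *
        (weightRatio x : ℂ) ^ m') (Set.Ioo 0 1) ∧
    Wstar d r y₁ y₂ m' = ((2 : ℂ) ^ (d + 1) * (Real.pi : ℂ))⁻¹ *
      (√((2 * d).choose (d + m'.natAbs)) : ℂ) *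
        ∫ x in Set.Ioo 0 1, whittakerKernel d r (2 * Real.pi * y₁) (2 * Real.pi * y₂) x *
          (weightRatio x : ℂ) ^ m' := by
  have hp₁ : 0 < 2 * Real.pi * y₁ := by positivity
  have hp₂ : 0 < 2 * Real.pi * y₂ := by positivity
  set p₁ := 2 * Real.pi * y₁
  set p₂ := 2 * Real.pi * y₂
  set m := m'.natAbs with hm
  have hmd : (m : ℝ) ≤ d := by
    rw [Finset.mem_Icc] at hm'
    exact_mod_cast (by omega : m ≤ d)
  have hd' : (2 : ℝ) ≤ d := by exact_mod_cast hd
  have key := fun ℓ : ℕ => integrableOn_barnesKernel_and_integral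
    (A₁ := ((d : ℂ) - 1) / 2 + 1 - r) (A₂ := ((d : ℂ) - 1) / 2 + 1 + r)
    (u := ((d : ℂ) - m + 1 + 2 * r) / 2) (v := ((ℓ : ℂ) + 1 - 2 * r) / 2)
    (by simp [hr]; linarith) (by simp [hr]; linarith) (by simp [hr]; linarith)
    (by simp [hr]; positivity) hp₁ hp₂
  have hsum : ∀ x ∈ Set.Ioo (0 : ℝ) 1, ∑ ℓ ∈ Finset.range (m + 1),
      (if 0 ≤ m' then (1 : ℂ) else -1) ^ ℓ * (m.choose ℓ : ℂ) *
        barnesKernel (((d : ℂ) - 1) / 2 + 1 - r) (((d : ℂ) - 1) / 2 + 1 + r)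
          (((d : ℂ) - m + 1 + 2 * r) / 2) (((ℓ : ℂ) + 1 - 2 * r) / 2) p₁ p₂ x =
      whittakerKernel d r p₁ p₂ x * (weightRatio x : ℂ) ^ m' := by
    intro x hx
    rw [← sum_choose_mul_sqrt_pow m' hx, ← mul_div_assoc, Finset.mul_sum, Finset.sum_div]
    refine Finset.sum_congr rfl fun ℓ _ => ?_
    rw [barnesKernel_eq_whittakerKernel d m ℓ r hp₁ hp₂ hx]
    ring
  have hinteg : ∀ ℓ ∈ Finset.range (m + 1), IntegrableOn (fun x =>
      (if 0 ≤ m' then (1 : ℂ) else -1) ^ ℓ * (m.choose ℓ : ℂ) *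
        barnesKernel (((d : ℂ) - 1) / 2 + 1 - r) (((d : ℂ) - 1) / 2 + 1 + r)
          (((d : ℂ) - m + 1 + 2 * r) / 2) (((ℓ : ℂ) + 1 - 2 * r) / 2) p₁ p₂ x) (Set.Ioo 0 1) :=
    fun ℓ _ => (key ℓ).1.const_mul _
  refine ⟨IntegrableOn.congr_fun (integrable_finsetSum _ hinteg) hsum measurableSet_Ioo, ?_⟩
  rw [← setIntegral_congr_fun measurableSet_Ioo hsum, integral_finsetSum _ hinteg, Wstar]
  congr 1
  refine Finset.sum_congr rfl fun ℓ _ => ?_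
  rw [integral_const_mul, mul_assoc _ ((((2 * Real.pi : ℝ) : ℂ))⁻¹ ^ 2)]
  congr 1
  rw [inv_pow, inv_mul_eq_iff_eq_mul₀ (by have := Real.pi_ne_zero; simp)]
  push_cast
  rw [← (key ℓ).2]
  refine integral_congr_ae (Filter.Eventually.of_forall fun t => ?_)
  simp only [p₁, p₂, m]
  push_cast
  ring_nf

lemma sum_Icc_choose_mul_zpow (d : ℕ) {q : ℂ} (hq : q ≠ 0) :
    ∑ m' ∈ Finset.Icc (-(d : ℤ)) (d : ℤ), ((2 * d).choose (d + m'.natAbs) : ℂ) * q ^ m' =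
      ((1 + q) ^ 2 / q) ^ d := by
  rw [div_pow, ← pow_mul, eq_div_iff (pow_ne_zero _ hq), add_comm, add_pow, Finset.sum_mul]
  refine Finset.sum_bij' (fun m' _ => (m' + d).toNat) (fun k _ => (k : ℤ) - d) ?_ ?_ ?_ ?_ ?_
  · intro m' h
    simp only [Finset.mem_Icc, Finset.mem_range] at *
    omega
  · intro k h
    simp only [Finset.mem_Icc, Finset.mem_range] at *
    omega
  · intro m' h
    simp only [Finset.mem_Icc] at *
    omega
  · intro k h
    simp
  · intro m' h
    simp only [Finset.mem_Icc] at h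
    have hc : (2 * d).choose (d + m'.natAbs) = (2 * d).choose (m' + d).toNat := by
      rcases le_total 0 m' with h0 | h0
      · congr 1; omega
      · rw [← Nat.choose_symm (by omega : (m' + d).toNat ≤ 2 * d)]
        congr 1; omega
    rw [hc, mul_assoc, ← zpow_natCast q d, ← zpow_add₀ hq, one_pow, mul_one, mul_comm,
      ← zpow_natCast q (m' + d).toNat, Int.toNat_of_nonneg (by omega)]

lemma one_add_weightRatio_mul_sq_div {x₁ x₂ : ℝ} (h₁ : x₁ ∈ Set.Ioo (0 : ℝ) 1)
    (h₂ : x₂ ∈ Set.Ioo (0 : ℝ) 1) :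
    (1 + weightRatio x₁ * weightRatio x₂) ^ 2 / (weightRatio x₁ * weightRatio x₂) =
      2 * (1 + √(x₁ * x₂) + √(1 - x₁) * √(1 - x₂)) / (√x₁ * √x₂) := by
  have hl₁ := weightRatio_pos h₁
  have hl₂ := weightRatio_pos h₂
  have hs₁ : 0 < √x₁ := Real.sqrt_pos.2 h₁.1
  have hs₂ : 0 < √x₂ := Real.sqrt_pos.2 h₂.1
  have e : (1 + weightRatio x₁ * weightRatio x₂) ^ 2 / (weightRatio x₁ * weightRatio x₂) =
      (weightRatio x₁)⁻¹ * (weightRatio x₂)⁻¹ + 2 + weightRatio x₁ * weightRatio x₂ := by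
    field_simp
    ring
  rw [e, weightRatio_inv h₁, weightRatio_inv h₂, weightRatio, weightRatio, Real.sqrt_mul h₁.1.le]
  field_simp
  ring

/-- The part of the integrand of `Psi` that does not depend on `y₁, y₂`. -/
noncomputable def pairingKernel (d : ℕ) (r r' : ℂ) (z : ℝ × ℝ) : ℂ :=
  (z.1 : ℂ) ^ (r - 1 - (((d : ℂ) - 1) / 2 - r) / 2) *
    ((1 - z.1 : ℝ) : ℂ) ^ (-r - 1 - (((d : ℂ) - 1) / 2 + r) / 2) *
      (z.2 : ℂ) ^ (r' - 1 - (((d : ℂ) - 1) / 2 - r') / 2) *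
        ((1 - z.2 : ℝ) : ℂ) ^ (-r' - 1 - (((d : ℂ) - 1) / 2 + r') / 2) *
    ((1 + √(z.1 * z.2) + √(1 - z.1) * √(1 - z.2) : ℝ) : ℂ) ^ d

lemma ae_mem_unit_square :
    ∀ᵐ z ∂((volume.restrict (Set.Ioo (0 : ℝ) 1)).prod (volume.restrict (Set.Ioo (0 : ℝ) 1))),
      z.1 ∈ Set.Ioo (0 : ℝ) 1 ∧ z.2 ∈ Set.Ioo (0 : ℝ) 1 :=
  (Measure.quasiMeasurePreserving_fst.ae (ae_restrict_mem measurableSet_Ioo)).and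
    (Measure.quasiMeasurePreserving_snd.ae (ae_restrict_mem measurableSet_Ioo))

lemma whittakerKernel_mul_sum (d : ℕ) (r r' : ℂ) {p₁ p₂ : ℝ} (hp₁ : 0 < p₁) (hp₂ : 0 < p₂)
    {x₁ x₂ : ℝ} (h₁ : x₁ ∈ Set.Ioo (0 : ℝ) 1) (h₂ : x₂ ∈ Set.Ioo (0 : ℝ) 1) :
    ∑ m' ∈ Finset.Icc (-(d : ℤ)) (d : ℤ), ((2 * d).choose (d + m'.natAbs) : ℂ) *
        ((whittakerKernel d r p₁ p₂ x₁ * (weightRatio x₁ : ℂ) ^ m') *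
          (whittakerKernel d r' p₁ p₂ x₂ * (weightRatio x₂ : ℂ) ^ m')) =
      2 ^ d * ((p₁ : ℂ) ^ ((d : ℂ) + 1 - r - r') * (p₂ : ℂ) ^ ((d : ℂ) + 1 + r + r')) *
        (pairingKernel d r r' (x₁, x₂) *
          (Complex.exp (-((p₁ * (1 / √x₁ + 1 / √x₂) : ℝ) : ℂ)) *
            Complex.exp (-((p₂ * (1 / √(1 - x₁) + 1 / √(1 - x₂)) : ℝ) : ℂ)))) := by
  have hl₁ := weightRatio_pos h₁
  have hl₂ := weightRatio_pos h₂
  have hx₁ : (x₁ : ℂ) ≠ 0 := by exact_mod_cast h₁.1.ne'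
  have hx₂ : (x₂ : ℂ) ≠ 0 := by exact_mod_cast h₂.1.ne'
  have hP₁ : (p₁ : ℂ) ≠ 0 := by exact_mod_cast hp₁.ne'
  have hP₂ : (p₂ : ℂ) ≠ 0 := by exact_mod_cast hp₂.ne'
  have hq : ((weightRatio x₁ : ℂ) * weightRatio x₂) ≠ 0 := by exact_mod_cast (mul_pos hl₁ hl₂).ne'
  have hsum := sum_Icc_choose_mul_zpow d hq
  have hw := congrArg (fun a : ℝ => (a : ℂ)) (one_add_weightRatio_mul_sq_div h₁ h₂)
  push_cast at hw
  rw [hw, div_pow, mul_pow, mul_pow, ofReal_sqrt_pow_eq_cpow h₁.1, ofReal_sqrt_pow_eq_cpow h₂.1]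
    at hsum
  have hfac : ∑ m' ∈ Finset.Icc (-(d : ℤ)) (d : ℤ), ((2 * d).choose (d + m'.natAbs) : ℂ) *
        ((whittakerKernel d r p₁ p₂ x₁ * (weightRatio x₁ : ℂ) ^ m') *
          (whittakerKernel d r' p₁ p₂ x₂ * (weightRatio x₂ : ℂ) ^ m')) =
      whittakerKernel d r p₁ p₂ x₁ * whittakerKernel d r' p₁ p₂ x₂ *
      ∑ m' ∈ Finset.Icc (-(d : ℤ)) (d : ℤ), ((2 * d).choose (d + m'.natAbs) : ℂ) *
        ((weightRatio x₁ : ℂ) * weightRatio x₂) ^ m' := by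
    rw [Finset.mul_sum]
    refine Finset.sum_congr rfl fun m' _ => ?_
    rw [mul_zpow]
    ring
  rw [hfac, hsum, whittakerKernel, whittakerKernel, pairingKernel, Complex.cpow_add _ _ hx₁,
    Complex.cpow_add _ _ hx₂,
    show (d : ℂ) + 1 - r - r' = (((d : ℂ) - 1) / 2 + 1 - r) + (((d : ℂ) - 1) / 2 + 1 - r') by ring,
    show (d : ℂ) + 1 + r + r' = (((d : ℂ) - 1) / 2 + 1 + r) + (((d : ℂ) - 1) / 2 + 1 + r') by ring,
    Complex.cpow_add _ _ hP₁,
    Complex.cpow_add (((d : ℂ) - 1) / 2 + 1 + r) (((d : ℂ) - 1) / 2 + 1 + r') hP₂,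
    show -((p₁ * (1 / √x₁ + 1 / √x₂) : ℝ) : ℂ) =
      -((p₁ / √x₁ : ℝ) : ℂ) + -((p₁ / √x₂ : ℝ) : ℂ) by push_cast; ring,
    show -((p₂ * (1 / √(1 - x₁) + 1 / √(1 - x₂)) : ℝ) : ℂ) =
      -((p₂ / √(1 - x₁) : ℝ) : ℂ) + -((p₂ / √(1 - x₂) : ℝ) : ℂ) by push_cast; ring,
    Complex.exp_add, Complex.exp_add]
  have hX₁ : (x₁ : ℂ) ^ ((d : ℂ) / 2) ≠ 0 := by simp [Complex.cpow_eq_zero_iff, hx₁]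
  have hX₂ : (x₂ : ℂ) ^ ((d : ℂ) / 2) ≠ 0 := by simp [Complex.cpow_eq_zero_iff, hx₂]
  push_cast
  generalize (x₁ : ℂ) ^ ((d : ℂ) / 2) = X₁ at *
  generalize (x₂ : ℂ) ^ ((d : ℂ) / 2) = X₂ at *
  rw [mul_div_assoc', div_eq_iff (mul_ne_zero hX₁ hX₂)]
  ring

/-- The pairing of two completed Whittaker functions as an elementary two-dimensional integral. -/
lemma sum_Wstar_mul_Wstar {d : ℕ} (hd : 2 ≤ d) {r r' : ℂ} (hr : r.re = 0) (hr' : r'.re = 0)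
    {y₁ y₂ : ℝ} (hy₁ : 0 < y₁) (hy₂ : 0 < y₂) :
    ∑ m' ∈ Finset.Icc (-(d : ℤ)) (d : ℤ), Wstar d r y₁ y₂ m' * Wstar d r' y₁ y₂ m' =
      ((2 : ℂ) ^ (d + 2) * (Real.pi : ℂ) ^ 2)⁻¹ *
        (((2 * Real.pi * y₁ : ℝ) : ℂ) ^ ((d : ℂ) + 1 - r - r') *
          ((2 * Real.pi * y₂ : ℝ) : ℂ) ^ ((d : ℂ) + 1 + r + r')) *
        ∫ z, pairingKernel d r r' z *
          (Complex.exp (-((2 * Real.pi * y₁ * (1 / √z.1 + 1 / √z.2) : ℝ) : ℂ)) *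
            Complex.exp (-((2 * Real.pi * y₂ * (1 / √(1 - z.1) + 1 / √(1 - z.2)) : ℝ) : ℂ)))
          ∂((volume.restrict (Set.Ioo (0 : ℝ) 1)).prod (volume.restrict (Set.Ioo (0 : ℝ) 1))) := by
  have hp₁ : 0 < 2 * Real.pi * y₁ := by positivity
  have hp₂ : 0 < 2 * Real.pi * y₂ := by positivity
  set p₁ := 2 * Real.pi * y₁
  set p₂ := 2 * Real.pi * y₂
  set μ := (volume.restrict (Set.Ioo (0 : ℝ) 1)).prod (volume.restrict (Set.Ioo (0 : ℝ) 1)) with hμ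
  have hW := fun m' hm' => Wstar_eq_integral hd hr hy₁ hy₂ (m' := m') hm'
  have hW' := fun m' hm' => Wstar_eq_integral hd hr' hy₁ hy₂ (m' := m') hm'
  have hinteg : ∀ m' ∈ Finset.Icc (-(d : ℤ)) (d : ℤ), Integrable (fun z : ℝ × ℝ =>
      ((2 * d).choose (d + m'.natAbs) : ℂ) *
        ((whittakerKernel d r p₁ p₂ z.1 * (weightRatio z.1 : ℂ) ^ m') *
          (whittakerKernel d r' p₁ p₂ z.2 * (weightRatio z.2 : ℂ) ^ m'))) μ := fun m' hm' =>
    ((hW m' hm').1.integrable.mul_prod (hW' m' hm').1.integrable).const_mul _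
  have hterm : ∀ m' ∈ Finset.Icc (-(d : ℤ)) (d : ℤ), Wstar d r y₁ y₂ m' * Wstar d r' y₁ y₂ m' =
      (((2 : ℂ) ^ (d + 1) * (Real.pi : ℂ))⁻¹) ^ 2 * ∫ z : ℝ × ℝ,
      ((2 * d).choose (d + m'.natAbs) : ℂ) *
        ((whittakerKernel d r p₁ p₂ z.1 * (weightRatio z.1 : ℂ) ^ m') *
          (whittakerKernel d r' p₁ p₂ z.2 * (weightRatio z.2 : ℂ) ^ m')) ∂μ := by
    intro m' hm'
    rw [integral_const_mul, hμ, integral_prod_mul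
      (fun x => whittakerKernel d r p₁ p₂ x * (weightRatio x : ℂ) ^ m')
      (fun x => whittakerKernel d r' p₁ p₂ x * (weightRatio x : ℂ) ^ m'), (hW m' hm').2,
      (hW' m' hm').2]
    have hsq : ((√((2 * d).choose (d + m'.natAbs)) : ℝ) : ℂ) ^ 2 =
        ((2 * d).choose (d + m'.natAbs) : ℂ) := by
      rw [← Complex.ofReal_pow, Real.sq_sqrt (Nat.cast_nonneg _), Complex.ofReal_natCast]
    rw [← hsq]
    ring
  rw [Finset.sum_congr rfl hterm, ← Finset.mul_sum, ← integral_finsetSum _ hinteg]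
  have hae : ∀ᵐ z ∂μ, ∑ m' ∈ Finset.Icc (-(d : ℤ)) (d : ℤ), ((2 * d).choose (d + m'.natAbs) : ℂ) *
        ((whittakerKernel d r p₁ p₂ z.1 * (weightRatio z.1 : ℂ) ^ m') *
          (whittakerKernel d r' p₁ p₂ z.2 * (weightRatio z.2 : ℂ) ^ m')) = _ :=
    ae_mem_unit_square.mono fun z hz => whittakerKernel_mul_sum d r r' hp₁ hp₂ hz.1 hz.2
  rw [integral_congr_ae hae, integral_const_mul, ← mul_assoc, ← mul_assoc]
  congr 2
  have := Real.pi_ne_zero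
  field_simp
  ring

lemma norm_cpow_mul_exp_neg {α : ℂ} {P y : ℝ} (hy : 0 < y) :
    ‖(y : ℂ) ^ (α - 1) * Complex.exp (-((y * P : ℝ) : ℂ))‖ =
      y ^ (α.re - 1) * Real.exp (-(P * y)) := by
  rw [norm_mul, Complex.norm_cpow_eq_rpow_re_of_pos hy, ← Complex.ofReal_neg,
    Complex.norm_exp_ofReal, mul_comm y P]
  simp

lemma integrableOn_cpow_mul_exp_neg {α : ℂ} (hα : 0 < α.re) {P : ℝ} (hP : 0 < P) :
    IntegrableOn (fun y : ℝ => (y : ℂ) ^ (α - 1) * Complex.exp (-((y * P : ℝ) : ℂ)))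
      (Set.Ioi 0) := by
  have h := integrableOn_rpow_mul_exp_neg_mul_rpow (p := 1) (s := α.re - 1) (by linarith)
    one_pos hP
  refine Integrable.mono' h (Measurable.aestronglyMeasurable (by fun_prop)) ?_
  filter_upwards [ae_restrict_mem measurableSet_Ioi] with y hy
  rw [norm_cpow_mul_exp_neg hy, Real.rpow_one, neg_mul]

lemma integral_cpow_mul_exp_neg {α : ℂ} (hα : 0 < α.re) {P : ℝ} (hP : 0 < P) :
    ∫ y : ℝ in Set.Ioi 0, (y : ℂ) ^ (α - 1) * Complex.exp (-((y * P : ℝ) : ℂ)) =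
      (P : ℂ) ^ (-α) * Complex.Gamma α := by
  have h := Complex.integral_cpow_mul_exp_neg_mul_Ioi hα hP
  rw [one_div, Complex.inv_cpow _ _ (by
    rw [Complex.arg_ofReal_of_nonneg hP.le]; exact Real.pi_pos.ne), ← Complex.cpow_neg] at h
  rw [← h]
  refine setIntegral_congr_fun measurableSet_Ioi fun y _ => ?_
  push_cast
  rw [mul_comm (y : ℂ) P]

lemma integral_norm_cpow_mul_exp_neg {α : ℂ} (hα : 0 < α.re) {P : ℝ} (hP : 0 < P) :
    ∫ y : ℝ in Set.Ioi 0, ‖(y : ℂ) ^ (α - 1) * Complex.exp (-((y * P : ℝ) : ℂ))‖ =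
      ‖(P : ℂ) ^ (-α)‖ * Real.Gamma α.re := by
  have h := Real.integral_rpow_mul_exp_neg_mul_Ioi hα hP
  rw [Complex.norm_cpow_eq_rpow_re_of_pos hP, Complex.neg_re, Real.rpow_neg hP.le,
    ← Real.inv_rpow hP.le, ← one_div, ← h]
  exact setIntegral_congr_fun measurableSet_Ioi fun y hy => norm_cpow_mul_exp_neg hy

/-- Integrating a superposition of exponentials against powers over a quadrant. -/
lemma integral_integral_cpow_mul_integral_exp {X : Type*} [MeasurableSpace X] {μ : Measure X}
    [SFinite μ] {E : X → ℂ} {P Q : X → ℝ} {α β : ℂ} (hα : 0 < α.re) (hβ : 0 < β.re)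
    (hE : Measurable E) (hP : Measurable P) (hQ : Measurable Q)
    (hpos : ∀ᵐ x ∂μ, 0 < P x ∧ 0 < Q x)
    (hinteg : Integrable (fun x => E x * ((P x : ℂ) ^ (-α) * (Q x : ℂ) ^ (-β))) μ) :
    ∫ y₁ : ℝ in Set.Ioi 0, ∫ y₂ : ℝ in Set.Ioi 0, ((y₁ : ℂ) ^ (α - 1) * (y₂ : ℂ) ^ (β - 1)) *
        ∫ x, E x * (Complex.exp (-((y₁ * P x : ℝ) : ℂ)) * Complex.exp (-((y₂ * Q x : ℝ) : ℂ))) ∂μ =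
      Complex.Gamma α * Complex.Gamma β *
        ∫ x, E x * ((P x : ℂ) ^ (-α) * (Q x : ℂ) ^ (-β)) ∂μ := by
  set ρ : Measure ℝ := volume.restrict (Set.Ioi 0) with hρ
  let G : ℝ × ℝ → X → ℂ := fun y x => E x *
    (((y.1 : ℂ) ^ (α - 1) * Complex.exp (-((y.1 * P x : ℝ) : ℂ))) *
      ((y.2 : ℂ) ^ (β - 1) * Complex.exp (-((y.2 * Q x : ℝ) : ℂ))))
  have hG : Integrable (Function.uncurry G) ((ρ.prod ρ).prod μ) := by
    rw [integrable_prod_iff' (Measurable.aestronglyMeasurable (by fun_prop))]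
    constructor
    · filter_upwards [hpos] with x hx
      exact ((integrableOn_cpow_mul_exp_neg hα hx.1).integrable.mul_prod
        (integrableOn_cpow_mul_exp_neg hβ hx.2).integrable).const_mul (E x)
    · refine ((hinteg.norm.mul_const (Real.Gamma α.re * Real.Gamma β.re))).congr ?_
      filter_upwards [hpos] with x hx
      simp only [Function.uncurry, G]
      simp_rw [norm_mul (E x)]
      rw [integral_const_mul]
      simp_rw [norm_mul ((_ : ℂ) ^ (α - 1) * _)]
      rw [integral_prod_mul
        (fun y : ℝ => ‖(y : ℂ) ^ (α - 1) * Complex.exp (-((y * P x : ℝ) : ℂ))‖)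
        (fun y : ℝ => ‖(y : ℂ) ^ (β - 1) * Complex.exp (-((y * Q x : ℝ) : ℂ))‖),
        integral_norm_cpow_mul_exp_neg hα hx.1, integral_norm_cpow_mul_exp_neg hβ hx.2, norm_mul]
      ring
  have hy : ∀ y : ℝ × ℝ, ((y.1 : ℂ) ^ (α - 1) * (y.2 : ℂ) ^ (β - 1)) *
      ∫ x, E x * (Complex.exp (-((y.1 * P x : ℝ) : ℂ)) *
        Complex.exp (-((y.2 * Q x : ℝ) : ℂ))) ∂μ = ∫ x, G y x ∂μ := by
    intro y
    rw [← integral_const_mul]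
    refine integral_congr_ae (Filter.Eventually.of_forall fun x => ?_)
    simp only [G]
    ring
  have hx : ∀ᵐ x ∂μ, ∫ y, G y x ∂(ρ.prod ρ) = Complex.Gamma α * Complex.Gamma β *
      (E x * ((P x : ℂ) ^ (-α) * (Q x : ℂ) ^ (-β))) := by
    filter_upwards [hpos] with x hx
    simp only [G]
    rw [integral_const_mul, integral_prod_mul
      (fun y : ℝ => (y : ℂ) ^ (α - 1) * Complex.exp (-((y * P x : ℝ) : ℂ)))
      (fun y : ℝ => (y : ℂ) ^ (β - 1) * Complex.exp (-((y * Q x : ℝ) : ℂ))),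
      integral_cpow_mul_exp_neg hα hx.1, integral_cpow_mul_exp_neg hβ hx.2]
    ring
  rw [← integral_const_mul, ← integral_congr_ae hx, ← integral_integral_swap hG,
    integral_prod (fun y => ∫ x, G y x ∂μ) hG.integral_prod_left]
  simp_rw [← hy]

/-- The integrand of the elementary integral representation of `Psi`. -/
noncomputable def elementaryKernel (d : ℕ) (r r' t : ℂ) (x₁ x₂ : ℝ) : ℂ :=
  ((x₁ : ℂ)) ^ ((((d : ℂ) - 1) / 2 + 2 * t + 2 * r - r') / 2 - 1) *
    (((1 - x₁ : ℝ)) : ℂ) ^ ((((d : ℂ) - 1) / 2 + t + r' - 2 * r) / 2 - 1) *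
      ((x₂ : ℂ)) ^ ((((d : ℂ) - 1) / 2 + 2 * t + 2 * r' - r) / 2 - 1) *
        (((1 - x₂ : ℝ)) : ℂ) ^ ((((d : ℂ) - 1) / 2 + t + r - 2 * r') / 2 - 1) *
    (((1 + √(x₁ * x₂) + √(1 - x₁) * √(1 - x₂) : ℝ)) : ℂ) ^ d *
      (((√x₁ + √x₂ : ℝ)) : ℂ) ^ (-((d : ℂ) - 1 + 2 * t - r - r')) *
        (((√(1 - x₁) + √(1 - x₂) : ℝ)) : ℂ) ^ (-((d : ℂ) - 1 + t + r + r'))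

lemma ofReal_one_div_sqrt_add_cpow_neg {x₁ x₂ : ℝ} (h₁ : 0 < x₁) (h₂ : 0 < x₂) (w : ℂ) :
    ((1 / √x₁ + 1 / √x₂ : ℝ) : ℂ) ^ (-w) =
      (x₁ : ℂ) ^ (w / 2) * (x₂ : ℂ) ^ (w / 2) * ((√x₁ + √x₂ : ℝ) : ℂ) ^ (-w) := by
  have hs₁ : 0 < √x₁ := Real.sqrt_pos.2 h₁
  have hs₂ : 0 < √x₂ := Real.sqrt_pos.2 h₂
  have e : 1 / √x₁ + 1 / √x₂ = (√x₁ + √x₂) / √(x₁ * x₂) := by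
    rw [Real.sqrt_mul h₁.le]
    field_simp
    ring
  rw [e, ofReal_div_sqrt_cpow (by positivity) (by positivity), neg_neg, Complex.ofReal_mul,
    Complex.mul_cpow_ofReal_nonneg h₁.le h₂.le]
  ring

lemma pairingKernel_mul_eq_elementaryKernel (d : ℕ) (r r' t : ℂ) {x₁ x₂ : ℝ}
    (h₁ : x₁ ∈ Set.Ioo (0 : ℝ) 1) (h₂ : x₂ ∈ Set.Ioo (0 : ℝ) 1) :
    pairingKernel d r r' (x₁, x₂) *
        (((1 / √x₁ + 1 / √x₂ : ℝ) : ℂ) ^ (-((d : ℂ) - 1 + 2 * t - r - r')) *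
          ((1 / √(1 - x₁) + 1 / √(1 - x₂) : ℝ) : ℂ) ^ (-((d : ℂ) - 1 + t + r + r'))) =
      elementaryKernel d r r' t x₁ x₂ := by
  have h1x₁ : 0 < 1 - x₁ := by linarith [h₁.2]
  have h1x₂ : 0 < 1 - x₂ := by linarith [h₂.2]
  have hx₁ : (x₁ : ℂ) ≠ 0 := by exact_mod_cast h₁.1.ne'
  have hx₂ : (x₂ : ℂ) ≠ 0 := by exact_mod_cast h₂.1.ne'
  have hx₁' : ((1 - x₁ : ℝ) : ℂ) ≠ 0 := by exact_mod_cast h1x₁.ne'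
  have hx₂' : ((1 - x₂ : ℝ) : ℂ) ≠ 0 := by exact_mod_cast h1x₂.ne'
  rw [ofReal_one_div_sqrt_add_cpow_neg h₁.1 h₂.1, ofReal_one_div_sqrt_add_cpow_neg h1x₁ h1x₂,
    pairingKernel, elementaryKernel,
    show (((d : ℂ) - 1) / 2 + 2 * t + 2 * r - r') / 2 - 1 =
      (r - 1 - (((d : ℂ) - 1) / 2 - r) / 2) + ((d : ℂ) - 1 + 2 * t - r - r') / 2 by ring,
    show (((d : ℂ) - 1) / 2 + t + r' - 2 * r) / 2 - 1 =
      (-r - 1 - (((d : ℂ) - 1) / 2 + r) / 2) + ((d : ℂ) - 1 + t + r + r') / 2 by ring,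
    show (((d : ℂ) - 1) / 2 + 2 * t + 2 * r' - r) / 2 - 1 =
      (r' - 1 - (((d : ℂ) - 1) / 2 - r') / 2) + ((d : ℂ) - 1 + 2 * t - r - r') / 2 by ring,
    show (((d : ℂ) - 1) / 2 + t + r - 2 * r') / 2 - 1 =
      (-r' - 1 - (((d : ℂ) - 1) / 2 + r') / 2) + ((d : ℂ) - 1 + t + r + r') / 2 by ring,
    Complex.cpow_add _ _ hx₁, Complex.cpow_add _ _ hx₂, Complex.cpow_add _ _ hx₁',
    Complex.cpow_add _ _ hx₂']
  ring

/-- A consequence of the arithmetic-geometric mean inequality. -/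
lemma sqrt_add_sqrt_rpow_neg_le {x₁ x₂ B : ℝ} (h₁ : 0 < x₁) (h₂ : 0 < x₂) (hB : 0 ≤ B) :
    (√x₁ + √x₂) ^ (-B) ≤ x₁ ^ (-B / 4) * x₂ ^ (-B / 4) := by
  have hs₁ : 0 < √x₁ := Real.sqrt_pos.2 h₁
  have hs₂ : 0 < √x₂ := Real.sqrt_pos.2 h₂
  have hle : (x₁ * x₂) ^ (1 / 4 : ℝ) ≤ √x₁ + √x₂ := by
    have h4 : (x₁ * x₂) ^ (1 / 4 : ℝ) = √(√x₁ * √x₂) := by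
      rw [← Real.sqrt_mul h₁.le, Real.sqrt_eq_rpow, Real.sqrt_eq_rpow, ← Real.rpow_mul (by positivity)]
      norm_num
    rw [h4]
    refine Real.sqrt_le_iff.2 ⟨by positivity, ?_⟩
    nlinarith [mul_pos hs₁ hs₂, sq_nonneg (√x₁), sq_nonneg (√x₂)]
  calc (√x₁ + √x₂) ^ (-B) ≤ ((x₁ * x₂) ^ (1 / 4 : ℝ)) ^ (-B) :=
        Real.rpow_le_rpow_of_nonpos (by positivity) hle (by linarith)
    _ = x₁ ^ (-B / 4) * x₂ ^ (-B / 4) := by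
        rw [← Real.rpow_mul (by positivity), ← Real.mul_rpow h₁.le h₂.le]
        ring_nf

lemma norm_elementaryKernel_le {d : ℕ} (hd : 1 ≤ d) {r r' : ℂ} (hr : r.re = 0) (hr' : r'.re = 0)
    {t : ℝ} (ht : 0 < t) {x₁ x₂ : ℝ} (h₁ : x₁ ∈ Set.Ioo (0 : ℝ) 1) (h₂ : x₂ ∈ Set.Ioo (0 : ℝ) 1) :
    ‖elementaryKernel d r r' t x₁ x₂‖ ≤ 3 ^ d *
      ((x₁ ^ (t / 2 - 1) * (1 - x₁) ^ (t / 4 - 1)) * (x₂ ^ (t / 2 - 1) * (1 - x₂) ^ (t / 4 - 1))) := by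
  have hd' : (1 : ℝ) ≤ d := by exact_mod_cast hd
  have p₁ := h₁.1
  have p₂ := h₂.1
  have q₁ : 0 < 1 - x₁ := by linarith [h₁.2]
  have q₂ : 0 < 1 - x₂ := by linarith [h₂.2]
  have hs₁ : 0 < √x₁ + √x₂ := add_pos (Real.sqrt_pos.2 p₁) (Real.sqrt_pos.2 p₂)
  have hs₂ : 0 < √(1 - x₁) + √(1 - x₂) := add_pos (Real.sqrt_pos.2 q₁) (Real.sqrt_pos.2 q₂)
  have hn : ‖(((1 + √(x₁ * x₂) + √(1 - x₁) * √(1 - x₂) : ℝ)) : ℂ)‖ ≤ 3 := by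
    rw [Complex.norm_real, Real.norm_of_nonneg (by positivity), ← Real.sqrt_mul q₁.le]
    have a : √(x₁ * x₂) ≤ 1 := Real.sqrt_le_one.2 (by nlinarith [h₁.2, h₂.2])
    have b : √((1 - x₁) * (1 - x₂)) ≤ 1 := Real.sqrt_le_one.2 (by nlinarith)
    linarith
  have e₁ := sqrt_add_sqrt_rpow_neg_le p₁ p₂ (B := d - 1 + 2 * t) (by linarith)
  have e₂ := sqrt_add_sqrt_rpow_neg_le q₁ q₂ (B := d - 1 + t) (by linarith)
  have re₁ : ((((d : ℂ) - 1) / 2 + 2 * (t : ℂ) + 2 * r - r') / 2 - 1).re =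
      (((d : ℝ) - 1) / 2 + 2 * t) / 2 - 1 := by simp [hr, hr']
  have re₂ : ((((d : ℂ) - 1) / 2 + (t : ℂ) + r' - 2 * r) / 2 - 1).re =
      (((d : ℝ) - 1) / 2 + t) / 2 - 1 := by simp [hr, hr']
  have re₃ : ((((d : ℂ) - 1) / 2 + 2 * (t : ℂ) + 2 * r' - r) / 2 - 1).re =
      (((d : ℝ) - 1) / 2 + 2 * t) / 2 - 1 := by simp [hr, hr']
  have re₄ : ((((d : ℂ) - 1) / 2 + (t : ℂ) + r - 2 * r') / 2 - 1).re =
      (((d : ℝ) - 1) / 2 + t) / 2 - 1 := by simp [hr, hr']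
  have re₅ : (-((d : ℂ) - 1 + 2 * (t : ℂ) - r - r')).re = -((d : ℝ) - 1 + 2 * t) := by
    simp [hr, hr']
  have re₆ : (-((d : ℂ) - 1 + (t : ℂ) + r + r')).re = -((d : ℝ) - 1 + t) := by simp [hr, hr']
  have hp : ∀ x : ℝ, 0 < x → x ^ (t / 2 - 1) =
      x ^ ((((d : ℝ) - 1) / 2 + 2 * t) / 2 - 1) * x ^ (-((d : ℝ) - 1 + 2 * t) / 4) := fun x hx => by
    rw [← Real.rpow_add hx]
    ring_nf
  have hq : ∀ x : ℝ, 0 < x → x ^ (t / 4 - 1) =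
      x ^ ((((d : ℝ) - 1) / 2 + t) / 2 - 1) * x ^ (-((d : ℝ) - 1 + t) / 4) := fun x hx => by
    rw [← Real.rpow_add hx]
    ring_nf
  rw [elementaryKernel, norm_mul, norm_mul, norm_mul, norm_mul, norm_mul, norm_mul, norm_pow,
    Complex.norm_cpow_eq_rpow_re_of_pos p₁, Complex.norm_cpow_eq_rpow_re_of_pos p₂,
    Complex.norm_cpow_eq_rpow_re_of_pos q₁, Complex.norm_cpow_eq_rpow_re_of_pos q₂,
    Complex.norm_cpow_eq_rpow_re_of_pos hs₁, Complex.norm_cpow_eq_rpow_re_of_pos hs₂,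
    re₁, re₂, re₃, re₄, re₅, re₆, hp x₁ p₁, hp x₂ p₂, hq _ q₁, hq _ q₂]
  calc _ ≤ x₁ ^ ((((d : ℝ) - 1) / 2 + 2 * t) / 2 - 1) * (1 - x₁) ^ ((((d : ℝ) - 1) / 2 + t) / 2 - 1) *
        x₂ ^ ((((d : ℝ) - 1) / 2 + 2 * t) / 2 - 1) * (1 - x₂) ^ ((((d : ℝ) - 1) / 2 + t) / 2 - 1) *
        3 ^ d * (x₁ ^ (-((d : ℝ) - 1 + 2 * t) / 4) * x₂ ^ (-((d : ℝ) - 1 + 2 * t) / 4)) *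
        ((1 - x₁) ^ (-((d : ℝ) - 1 + t) / 4) * (1 - x₂) ^ (-((d : ℝ) - 1 + t) / 4)) := by
        gcongr
    _ = _ := by ring

lemma integrable_elementaryKernel {d : ℕ} (hd : 1 ≤ d) {r r' : ℂ} (hr : r.re = 0)
    (hr' : r'.re = 0) {t : ℝ} (ht : 0 < t) :
    Integrable (fun z : ℝ × ℝ => elementaryKernel d r r' t z.1 z.2)
      ((volume.restrict (Set.Ioo (0 : ℝ) 1)).prod (volume.restrict (Set.Ioo (0 : ℝ) 1))) := by
  have hb : IntegrableOn (fun x : ℝ => x ^ (t / 2 - 1) * (1 - x) ^ (t / 4 - 1)) (Set.Ioo 0 1) := by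
    have h := (integrableOn_beta_kernel (u := (t / 2 : ℝ)) (v := (t / 4 : ℝ))
      (by rw [Complex.ofReal_re]; positivity) (by rw [Complex.ofReal_re]; positivity)).norm
    refine IntegrableOn.congr_fun h (fun x hx => ?_) measurableSet_Ioo
    rw [norm_mul, Complex.norm_cpow_eq_rpow_re_of_pos hx.1,
      Complex.norm_cpow_eq_rpow_re_of_pos (by linarith [hx.2])]
    simp only [Complex.sub_re, Complex.ofReal_re, Complex.one_re]
  refine ((hb.integrable.mul_prod hb.integrable).const_mul (3 ^ d)).mono'
    (Measurable.aestronglyMeasurable (by unfold elementaryKernel; fun_prop)) ?_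
  exact ae_mem_unit_square.mono fun z hz => norm_elementaryKernel_le hd hr hr' ht hz.1 hz.2

/-- The elementary two-dimensional integral representation of `Ψ^d(r, r', t)`. -/
theorem Psi_eq_elementary_integral (d : ℕ) (hd : 2 ≤ d) (r r' : ℂ) (hr : r.re = 0)
    (hr' : r'.re = 0) (t : ℝ) (ht : 0 < t) :
    Psi d r r' (t : ℂ) =
      (((2 * Real.pi : ℝ) : ℂ)) ^ (4 - 3 * (t : ℂ)) / ((2 : ℂ) ^ (d + 2) * (Real.pi : ℂ) ^ 2) *
        Complex.Gamma ((d : ℂ) - 1 + 2 * (t : ℂ) - r - r') *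
          Complex.Gamma ((d : ℂ) - 1 + (t : ℂ) + r + r') *
        ∫ x₁ in Set.Ioo (0 : ℝ) 1, ∫ x₂ in Set.Ioo (0 : ℝ) 1,
          ((x₁ : ℂ)) ^ ((((d : ℂ) - 1) / 2 + 2 * (t : ℂ) + 2 * r - r') / 2 - 1) *
            (((1 - x₁ : ℝ)) : ℂ) ^ ((((d : ℂ) - 1) / 2 + (t : ℂ) + r' - 2 * r) / 2 - 1) *
              ((x₂ : ℂ)) ^ ((((d : ℂ) - 1) / 2 + 2 * (t : ℂ) + 2 * r' - r) / 2 - 1) *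
                (((1 - x₂ : ℝ)) : ℂ) ^ ((((d : ℂ) - 1) / 2 + (t : ℂ) + r - 2 * r') / 2 - 1) *
            (((1 + Real.sqrt (x₁ * x₂) + Real.sqrt (1 - x₁) * Real.sqrt (1 - x₂) : ℝ)) : ℂ) ^ d *
              (((Real.sqrt x₁ + Real.sqrt x₂ : ℝ)) : ℂ) ^ (-((d : ℂ) - 1 + 2 * (t : ℂ) - r - r')) *
                (((Real.sqrt (1 - x₁) + Real.sqrt (1 - x₂) : ℝ)) : ℂ) ^
                  (-((d : ℂ) - 1 + (t : ℂ) + r + r')) := by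
  have hd' : (2 : ℝ) ≤ d := by exact_mod_cast hd
  have hpi : 0 < 2 * Real.pi := by positivity
  have hpic : ((2 * Real.pi : ℝ) : ℂ) ≠ 0 := by exact_mod_cast hpi.ne'
  set α : ℂ := (d : ℂ) - 1 + 2 * (t : ℂ) - r - r' with hα
  set β : ℂ := (d : ℂ) - 1 + (t : ℂ) + r + r' with hβ
  set μ := (volume.restrict (Set.Ioo (0 : ℝ) 1)).prod (volume.restrict (Set.Ioo (0 : ℝ) 1)) with hμ
  have hα0 : 0 < α.re := by simp [hα, hr, hr']; linarith
  have hβ0 : 0 < β.re := by simp [hβ, hr, hr']; linarith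
  have hae : ∀ᵐ z ∂μ, pairingKernel d r r' z * (((1 / √z.1 + 1 / √z.2 : ℝ) : ℂ) ^ (-α) *
      ((1 / √(1 - z.1) + 1 / √(1 - z.2) : ℝ) : ℂ) ^ (-β)) =
      elementaryKernel d r r' t z.1 z.2 := ae_mem_unit_square.mono fun z hz =>
    pairingKernel_mul_eq_elementaryKernel d r r' t hz.1 hz.2
  have hinteg := integrable_elementaryKernel (by omega : 1 ≤ d) hr hr' ht
  have hlaplace := integral_integral_cpow_mul_integral_exp (μ := μ) (E := pairingKernel d r r')
    (P := fun z : ℝ × ℝ => 1 / √z.1 + 1 / √z.2)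
    (Q := fun z : ℝ × ℝ => 1 / √(1 - z.1) + 1 / √(1 - z.2)) hα0 hβ0
    (by unfold pairingKernel; fun_prop) (by fun_prop) (by fun_prop)
    (ae_mem_unit_square.mono fun z hz => by
      have a := Real.sqrt_pos.2 hz.1.1
      have b := Real.sqrt_pos.2 hz.2.1
      have c := Real.sqrt_pos.2 (sub_pos.2 hz.1.2)
      have e := Real.sqrt_pos.2 (sub_pos.2 hz.2.2)
      constructor <;> positivity)
    (hinteg.congr (hae.mono fun z hz => hz.symm))
  rw [integral_congr_ae hae, integral_prod _ hinteg] at hlaplace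
  let f : ℝ → ℝ → ℂ := fun y₁ y₂ => ((y₁ : ℂ) ^ (α - 1) * (y₂ : ℂ) ^ (β - 1)) *
    ∫ z, pairingKernel d r r' z * (Complex.exp (-((y₁ * (1 / √z.1 + 1 / √z.2) : ℝ) : ℂ)) *
      Complex.exp (-((y₂ * (1 / √(1 - z.1) + 1 / √(1 - z.2)) : ℝ) : ℂ))) ∂μ
  have hscale : ∫ y₁ in Set.Ioi (0 : ℝ), ∫ y₂ in Set.Ioi (0 : ℝ),
      f (2 * Real.pi * y₁) (2 * Real.pi * y₂) = ((2 * Real.pi : ℝ) : ℂ)⁻¹ ^ 2 *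
        ∫ y₁ in Set.Ioi (0 : ℝ), ∫ y₂ in Set.Ioi (0 : ℝ), f y₁ y₂ := by
    simp_rw [fun y₁ : ℝ => integral_comp_mul_left_Ioi (f (2 * Real.pi * y₁)) 0 hpi, mul_zero,
      integral_smul]
    rw [integral_comp_mul_left_Ioi (fun y₁ => ∫ y₂ in Set.Ioi (0 : ℝ), f y₁ y₂) 0 hpi, mul_zero,
      smul_smul, Complex.real_smul]
    push_cast
    ring
  have hpoint : ∀ y₁ ∈ Set.Ioi (0 : ℝ), ∀ y₂ ∈ Set.Ioi (0 : ℝ),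
      (∑ m' ∈ Finset.Icc (-(d : ℤ)) (d : ℤ), Wstar d r y₁ y₂ m' * Wstar d r' y₁ y₂ m') *
        ((y₁ ^ 2 * y₂ : ℝ) : ℂ) ^ (t : ℂ) / ((y₁ * y₂ : ℝ) : ℂ) ^ 3 =
      (((2 : ℂ) ^ (d + 2) * (Real.pi : ℂ) ^ 2)⁻¹ * ((2 * Real.pi : ℝ) : ℂ) ^ (6 - 3 * (t : ℂ))) *
        f (2 * Real.pi * y₁) (2 * Real.pi * y₂) := by
    intro y₁ hy₁ y₂ hy₂
    have hy₁ : 0 < y₁ := hy₁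
    have hy₂ : 0 < y₂ := hy₂
    have hc₁ : (y₁ : ℂ) ≠ 0 := by exact_mod_cast hy₁.ne'
    have hc₂ : (y₂ : ℂ) ≠ 0 := by exact_mod_cast hy₂.ne'
    have hpow : (((2 * Real.pi * y₁ : ℝ) : ℂ) ^ ((d : ℂ) + 1 - r - r') *
          ((2 * Real.pi * y₂ : ℝ) : ℂ) ^ ((d : ℂ) + 1 + r + r')) *
          (((y₁ ^ 2 * y₂ : ℝ) : ℂ) ^ (t : ℂ) / ((y₁ * y₂ : ℝ) : ℂ) ^ 3) =
        ((2 * Real.pi : ℝ) : ℂ) ^ (6 - 3 * (t : ℂ)) *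
          (((2 * Real.pi * y₁ : ℝ) : ℂ) ^ (α - 1) * ((2 * Real.pi * y₂ : ℝ) : ℂ) ^ (β - 1)) := by
      have hexp : ∀ y : ℝ, 0 < y → ∀ w : ℂ, (y : ℂ) ^ w = Complex.exp (w * (Real.log y : ℂ)) :=
        fun y hy w => by
          rw [Complex.cpow_def_of_ne_zero (by exact_mod_cast hy.ne'), Complex.ofReal_log hy.le,
            mul_comm]
      rw [← Complex.cpow_natCast, hexp _ (by positivity), hexp _ (by positivity),
        hexp _ (by positivity), hexp _ (by positivity), hexp _ (by positivity),
        hexp _ (by positivity), hexp _ (by positivity), ← Complex.exp_sub, ← Complex.exp_add,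
        ← Complex.exp_add, ← Complex.exp_add, ← Complex.exp_add, Real.log_mul hpi.ne' hy₁.ne',
        Real.log_mul hpi.ne' hy₂.ne', Real.log_mul (by positivity) hy₂.ne',
        Real.log_mul hy₁.ne' hy₂.ne', Real.log_pow, hα, hβ]
      congr 1
      push_cast
      ring
    rw [sum_Wstar_mul_Wstar hd hr hr' hy₁ hy₂]
    simp only [f]
    linear_combination (((2 : ℂ) ^ (d + 2) * (Real.pi : ℂ) ^ 2)⁻¹ *
      ∫ z, pairingKernel d r r' z *
        (Complex.exp (-((2 * Real.pi * y₁ * (1 / √z.1 + 1 / √z.2) : ℝ) : ℂ)) *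
          Complex.exp (-((2 * Real.pi * y₂ * (1 / √(1 - z.1) + 1 / √(1 - z.2)) : ℝ) : ℂ))) ∂μ) * hpow
  have hPsi : Psi d r r' t = (((2 : ℂ) ^ (d + 2) * (Real.pi : ℂ) ^ 2)⁻¹ *
      ((2 * Real.pi : ℝ) : ℂ) ^ (6 - 3 * (t : ℂ))) *
        ∫ y₁ in Set.Ioi (0 : ℝ), ∫ y₂ in Set.Ioi (0 : ℝ), f (2 * Real.pi * y₁) (2 * Real.pi * y₂) := by
    rw [Psi, ← integral_const_mul]
    refine setIntegral_congr_fun measurableSet_Ioi fun y₁ hy₁ => ?_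
    rw [← integral_const_mul]
    exact setIntegral_congr_fun measurableSet_Ioi fun y₂ hy₂ => hpoint y₁ hy₁ y₂ hy₂
  rw [hPsi, hscale, hlaplace, show (6 : ℂ) - 3 * t = (4 - 3 * t) + (2 : ℕ) by push_cast; ring,
    Complex.cpow_add _ _ hpic, Complex.cpow_natCast]
  simp only [elementaryKernel, ← hα, ← hβ]
  field_simp
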